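/- Let A and X be nonempty finite sets, let c : X → A → ℝ be a family of real coefficients, and let β ≥ 0 be a real number such that for every family r : X → A → ℝ of conditional probability distributions (i.e., r(x)(a) ≥ 0 and Σ_{a∈A} r(x)(a) = 1 for every x), one has | Σ_{x∈X} Σ_{a∈A} c(x)(a) · r(x)(a) | ≤ β. Let p, q : X → A → ℝ be two families of conditional probability distributions such that for every x ∈ X the total variation distance satisfies (1/2)·Σ_{a∈A} | p(x)(a) − q(x)(a) | ≤ ε. Then | Σ_{x∈X} Σ_{a∈A} c(x)(a) · ( p(x)(a) − q(x)(a) ) | ≤ 2·ε·β. (Consequently, the post-selected expectation value of a linear Bell operator deviates from the ideal one by at most 2ε times the algebraic bound of the operator.) -/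

import Mathlib

/-- A bound on Bell values over conditional distributions scales to nonnegative families all of
whose rows have the same total mass `m`. -/
theorem abs_bell_value_le_mass_mul {A X : Type*} [Fintype A] [Fintype X]
    {c : X → A → ℝ} {β : ℝ}
    (hβ : ∀ r : X → A → ℝ, (∀ x a, 0 ≤ r x a) → (∀ x, ∑ a, r x a = 1) →
      |∑ x, ∑ a, c x a * r x a| ≤ β)
    {m : ℝ} (hm : 0 ≤ m) {P : X → A → ℝ}
    (hP0 : ∀ x a, 0 ≤ P x a) (hP1 : ∀ x, ∑ a, P x a = m) :
    |∑ x, ∑ a, c x a * P x a| ≤ m * β := by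
  rcases hm.eq_or_lt with rfl | hm
  · have hP : ∀ x a, P x a = 0 := fun x a =>
      (Finset.sum_eq_zero_iff_of_nonneg fun a _ => hP0 x a).1 (hP1 x) a (Finset.mem_univ a)
    simp [hP]
  · have hr := hβ (fun x a => P x a / m) (fun x a => div_nonneg (hP0 x a) hm.le)
      (fun x => by rw [← Finset.sum_div, hP1, div_self hm.ne'])
    simp only [← mul_div_assoc, ← Finset.sum_div] at hr
    rwa [abs_div, abs_of_pos hm, div_le_iff₀' hm] at hr

/-- If every conditional probability distribution gives a Bell value bounded by `β`,
and `p, q` are conditional distributions at total variation distance at most `ε` for every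
setting, then the Bell expectation values of `p` and `q` differ by at most `2 ε β`. -/
theorem bell_value_deviation_le
    (A X : Type*) [Fintype A] [Nonempty A] [Fintype X] [Nonempty X]
    (c : X → A → ℝ) (β : ℝ) (hβ0 : 0 ≤ β)
    (hβ : ∀ r : X → A → ℝ, (∀ x a, 0 ≤ r x a) → (∀ x, ∑ a, r x a = 1) →
      |∑ x, ∑ a, c x a * r x a| ≤ β)
    (p q : X → A → ℝ)
    (hp0 : ∀ x a, 0 ≤ p x a) (hp1 : ∀ x, ∑ a, p x a = 1)
    (hq0 : ∀ x a, 0 ≤ q x a) (hq1 : ∀ x, ∑ a, q x a = 1)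
    (ε : ℝ) (htv : ∀ x, (1 / 2) * ∑ a, |p x a - q x a| ≤ ε) :
    |∑ x, ∑ a, c x a * (p x a - q x a)| ≤ 2 * ε * β := by
  have hε : 0 ≤ ε := by
    obtain ⟨x⟩ := ‹Nonempty X›
    exact le_trans (by positivity) (htv x)
  -- The positive and negative parts of `p - q`, padded by a multiple of `p` to row mass `ε`.
  let P : X → A → ℝ := fun x a =>
    (|p x a - q x a| + (p x a - q x a)) / 2 + (ε - (1 / 2) * ∑ b, |p x b - q x b|) * p x a
  let Q : X → A → ℝ := fun x a =>
    (|p x a - q x a| - (p x a - q x a)) / 2 + (ε - (1 / 2) * ∑ b, |p x b - q x b|) * p x a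
  have hpad : ∀ x a, 0 ≤ (ε - (1 / 2) * ∑ b, |p x b - q x b|) * p x a := fun x a =>
    mul_nonneg (sub_nonneg.2 (htv x)) (hp0 x a)
  have hP := abs_bell_value_le_mass_mul hβ hε (P := P)
    (fun x a => by
      dsimp only [P]
      linarith [hpad x a, neg_abs_le (p x a - q x a)])
    (fun x => by
      simp only [P, Finset.sum_add_distrib, ← Finset.sum_div, ← Finset.mul_sum,
        Finset.sum_sub_distrib, hp1, hq1]
      ring)
  have hQ := abs_bell_value_le_mass_mul hβ hε (P := Q)
    (fun x a => by
      dsimp only [Q]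
      linarith [hpad x a, le_abs_self (p x a - q x a)])
    (fun x => by
      simp only [Q, Finset.sum_add_distrib, ← Finset.sum_div, ← Finset.mul_sum,
        Finset.sum_sub_distrib, hp1, hq1]
      ring)
  have hPQ : ∑ x, ∑ a, c x a * (p x a - q x a)
      = ∑ x, ∑ a, c x a * P x a - ∑ x, ∑ a, c x a * Q x a := by
    simp only [← Finset.sum_sub_distrib]
    refine Finset.sum_congr rfl fun x _ => Finset.sum_congr rfl fun a _ => ?_
    dsimp only [P, Q]
    ring
  rw [hPQ]
  linarith [abs_sub (∑ x, ∑ a, c x a * P x a) (∑ x, ∑ a, c x a * Q x a)]
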